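/- Let m ≥ 2, I = {1,…,m}, H ⊆ ℤ^m, and let ℓ : ℤ^m → ℤ satisfy (P2) and (P4). Define d_i(β) = ℓ(β) − ℓ(β − e_i) and p_i(α) = (−1)^{m−1} Σ_{J ⊆ I∖{i}} (−1)^{#J} d_i(α − 𝟙 + 𝟙_J + e_i). If α ∈ H is not maximal, i.e. ∇(α) ≠ ∅, then p_i(α) = 0 for every i ∈ I. -/

import Mathlib

open Finset

variable {m : ℕ}

/-- The indicator vector `𝟙_J ∈ ℤ^m` of a subset `J ⊆ {1,…,m}`. -/
def indJ (J : Finset (Fin m)) : Fin m → ℤ := fun j => if j ∈ J then 1 else 0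

/-- `d_i(β) = ℓ(β) - ℓ(β - e_i)`. -/
def dcoef (ℓ : (Fin m → ℤ) → ℤ) (i : Fin m) (β : Fin m → ℤ) : ℤ :=
  ℓ β - ℓ (β - Pi.single i 1)

/-- `p_i(α) = (-1)^(m-1) Σ_{J ⊆ I∖{i}} (-1)^{#J} d_i(α - 𝟙 + 𝟙_J + e_i)`. -/
def pcoef (ℓ : (Fin m → ℤ) → ℤ) (i : Fin m) (α : Fin m → ℤ) : ℤ :=
  (-1 : ℤ) ^ (m - 1) *
    ∑ J ∈ ((Finset.univ : Finset (Fin m)).erase i).powerset,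
      (-1 : ℤ) ^ J.card * dcoef ℓ i (α - 1 + indJ J + Pi.single i 1)

/-- `∇_i^m(α) = {β ∈ H : β_i = α_i and β_j ≤ α_j for j ≠ i}`. -/
def nablaIm (H : Set (Fin m → ℤ)) (i : Fin m) (α : Fin m → ℤ) : Set (Fin m → ℤ) :=
  {β | β ∈ H ∧ β i = α i ∧ ∀ j ≠ i, β j ≤ α j}

/-- `∇(α) = ∪_i ∇_i(α)` where `∇_i(α) = {β ∈ H : β_i = α_i, β_j < α_j ∀ j ≠ i}`. -/
def nabla (H : Set (Fin m → ℤ)) (α : Fin m → ℤ) : Set (Fin m → ℤ) :=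
  {β | β ∈ H ∧ ∃ i : Fin m, β i = α i ∧ ∀ j ≠ i, β j < α j}

theorem pcoef_eq_aux (ℓ : (Fin m → ℤ) → ℤ) (i : Fin m) (α : Fin m → ℤ) :
    pcoef ℓ i α = (-1 : ℤ) ^ (m - 1) *
      -(∑ J ∈ (Finset.univ : Finset (Fin m)).powerset, (-1 : ℤ) ^ J.card * ℓ (α - 1 + indJ J)) := by
  have hu : (Finset.univ : Finset (Fin m)) = insert i (Finset.univ.erase i) := by simp
  have hni : i ∉ (Finset.univ : Finset (Fin m)).erase i := by simp
  unfold pcoef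
  congr 1
  conv_rhs => rw [hu, Finset.sum_powerset_insert hni]
  rw [← Finset.sum_add_distrib, ← Finset.sum_neg_distrib]
  refine Finset.sum_congr rfl fun J hJ => ?_
  have hiJ : i ∉ J := fun h => hni (Finset.mem_powerset.1 hJ h)
  have e : α - 1 + indJ (insert i J) = α - 1 + indJ J + Pi.single i 1 := by
    funext j
    by_cases hj : j = i
    · subst hj; simp [indJ, hiJ]
    · simp [indJ, hj]
  rw [Finset.card_insert_of_notMem hiJ, e, dcoef, add_sub_cancel_right]
  ring

/-- Proposition 4.1(b) of the paper: under (P2) and (P4),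
if `α ∈ H` is not maximal, i.e. `∇(α) ≠ ∅`, then `p_i(α) = 0` for every `i`. -/
theorem statement10 (hm : 2 ≤ m) (H : Set (Fin m → ℤ)) (ℓ : (Fin m → ℤ) → ℤ)
    (hP2 : ∀ (γ : Fin m → ℤ) (i : Fin m),
      nablaIm H i γ = ∅ ↔ ℓ γ = ℓ (γ - Pi.single i 1))
    (hP4 : ∀ (γ : Fin m → ℤ) (i : Fin m),
      ℓ γ - ℓ (γ - Pi.single i 1) = 0 ∨ ℓ γ - ℓ (γ - Pi.single i 1) = 1)
    (α : Fin m → ℤ) (hα : α ∈ H) (hnm : nabla H α ≠ ∅) (i : Fin m) :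
    pcoef ℓ i α = 0 := by
  obtain ⟨β, hβ, k, hk, hlt⟩ := Set.nonempty_iff_ne_empty.2 hnm
  rw [pcoef_eq_aux, ← pcoef_eq_aux ℓ k α]
  unfold pcoef
  have hne : ((Finset.univ : Finset (Fin m)).erase k).Nonempty := by
    rw [← Finset.card_pos, Finset.card_erase_of_mem (Finset.mem_univ k), Finset.card_univ,
      Fintype.card_fin]
    omega
  have h0 := Finset.sum_powerset_neg_one_pow_card_of_nonempty hne
  rw [Finset.sum_congr rfl (g := fun J => (-1 : ℤ) ^ J.card), h0, mul_zero]
  intro J hJ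
  have hkJ : k ∉ J := fun h => by simpa using Finset.mem_powerset.1 hJ h
  suffices h : dcoef ℓ k (α - 1 + indJ J + Pi.single k 1) = 1 by rw [h, mul_one]
  refine (hP4 _ k).resolve_left fun h => ?_
  have he := (hP2 _ k).2 (sub_eq_zero.1 h)
  have : β ∈ nablaIm H k (α - 1 + indJ J + Pi.single k 1) := by
    refine ⟨hβ, ?_, fun j hj => ?_⟩
    · simp [indJ, hkJ, hk]
    · have := hlt j hj
      simp only [indJ, Pi.add_apply, Pi.sub_apply, Pi.one_apply, Pi.single_eq_of_ne hj]
      split_ifs <;> omega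
  rw [he] at this
  exact this
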